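/- arXiv:1608.05008 — 2 statements merged into one kernel-verified Lean document; each statement's English description precedes it below -/
import Mathlib

section
/- For ν > 1, a ∈ F_{2^{m_1}}^*, b ∈ F_4^* and every ω ∈ F_{2^n}^*, one has 3·(2^m − 1)·(W_{f_{a,b}}(ω) − 1 − 2^m·Σ₀) = (2^{2^{ν−1}·m} − 1)·(1 − K_{m_1}(a)), where Σ₀ = ∑_{u ∈ U, Tr^n_m(ω·u) = 0} (−1)^{f_{a,b}(u)}. -/
open Finset

attribute [local instance] Classical.propDecidable

noncomputable section

/-- The absolute trace `Tr^k` of `GF(2^k)`, as a function on an ambient field of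
characteristic two containing `GF(2^k)`. -/
def absTr {F : Type*} [Field F] (k : ℕ) (x : F) : F :=
  ∑ i ∈ Finset.range k, x ^ 2 ^ i

/-- The relative field trace `Tr^k_j` from `GF(2^k)` to `GF(2^j)`. -/
def relTr {F : Type*} [Field F] (k j : ℕ) (x : F) : F :=
  ∑ i ∈ Finset.range (k / j), x ^ 2 ^ (j * i)

/-- `(-1)^b` for `b ∈ F_2`, viewed inside an ambient field of characteristic two. -/
def sgn {F : Type*} [Field F] (b : F) : ℤ := if b = 0 then 1 else -1

/-- The subfield `GF(2^k)` of the ambient field, as a finset. -/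
def gf (F : Type*) [Field F] [Fintype F] (k : ℕ) : Finset F :=
  Finset.univ.filter fun x => x ^ 2 ^ k = x

/-- The trace of `F_4` down to `F_2`, `tr_2(y) = y + y²`. -/
def tr2 {F : Type*} [Field F] (y : F) : F := y + y ^ 2

/-- The cubic multiplicative character `χ_k(x) = x^((2^k-1)/3)` of `GF(2^k)`. -/
def chi {F : Type*} [Field F] (k : ℕ) (x : F) : F := x ^ ((2 ^ k - 1) / 3)

/-- The Walsh transform at `ω` of a Boolean function on `GF(2^n)`
(with values in `F_2` inside the ambient field). -/
def walsh {F : Type*} [Field F] [Fintype F] (n : ℕ) (f : F → F) (ω : F) : ℤ :=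
  ∑ x : F, sgn (f x + absTr n (ω * x))

/-- The binary Kloosterman sum `K_k(a)` (with the convention `0⁻¹ = 0`). -/
def kloo {F : Type*} [Field F] [Fintype F] (k : ℕ) (a : F) : ℤ :=
  ∑ x ∈ gf F k, sgn (absTr k (a * x + x⁻¹))

/-- The binary cubic sum `C_k(a,b)`. -/
def cub {F : Type*} [Field F] [Fintype F] (k : ℕ) (a b : F) : ℤ :=
  ∑ x ∈ gf F k, sgn (absTr k (a * x ^ 3 + b * x))

/-- `f_a(x) = Tr^n(a · x^(2^{m₁}-1))`. -/
def fA {F : Type*} [Field F] (n m1 : ℕ) (a x : F) : F :=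
  absTr n (a * x ^ (2 ^ m1 - 1))

/-- `g_b(x) = tr_2(b · χ_n(x))`. -/
def gB {F : Type*} [Field F] (n : ℕ) (b x : F) : F := tr2 (b * chi n x)

/-- The binomial Boolean function `f_{a,b} = f_a + g_b`. -/
def fAB {F : Type*} [Field F] (n m1 : ℕ) (a b x : F) : F :=
  fA n m1 a x + gB n b x

/-- `U`, the image of `U_1 × ⋯ × U_ν` in `GF(2^n)^*` under multiplication, where
`U_i` is the subgroup of `(2^{m_i}+1)`-th roots of unity and `m_i = 2^{ν-i}·m`. -/
def bigU (F : Type*) [Field F] [Fintype F] (ν m : ℕ) : Finset F :=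
  Finset.univ.filter fun u => ∃ c : Fin ν → F,
    (∀ i : Fin ν, c i ^ (2 ^ (2 ^ (ν - 1 - (i : ℕ)) * m) + 1) = 1) ∧ u = ∏ i, c i

theorem absTr_add {F : Type*} [Field F] [CharP F 2] (k : ℕ) (x y : F) :
    absTr k (x + y) = absTr k x + absTr k y := by
  simp [absTr, add_pow_char_pow, Finset.sum_add_distrib]

theorem absTr_sq {F : Type*} [Field F] [CharP F 2] (k : ℕ) {x : F} (hx : x ^ 2 ^ k = x) :
    absTr k x ^ 2 = absTr k x := by
  unfold absTr
  rw [sum_pow_char]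
  have h := Finset.sum_range_succ' (fun i => x ^ 2 ^ i) k
  rw [Finset.sum_range_succ, hx, pow_zero, pow_one] at h
  simpa [pow_succ, pow_mul] using (add_right_cancel h).symm

theorem absTr_pow_two {F : Type*} [Field F] (k : ℕ) {x : F} (hx : x ^ 2 ^ k = x) :
    absTr k (x ^ 2) = absTr k x := by
  unfold absTr
  have h := Finset.sum_range_succ' (fun i => x ^ 2 ^ i) k
  rw [Finset.sum_range_succ, hx, pow_zero, pow_one] at h
  simpa only [← pow_mul, ← pow_succ'] using (add_right_cancel h).symm

theorem sgn_add_of_sq_eq {F : Type*} [Field F] [CharP F 2] {x y : F} (hx : x ^ 2 = x)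
    (hy : y ^ 2 = y) : sgn (x + y) = sgn x * sgn y := by
  have key : ∀ z : F, z ^ 2 = z → z = 0 ∨ z = 1 := fun z hz => by
    rcases eq_or_ne z 0 with h | h
    · exact Or.inl h
    · exact Or.inr (mul_left_cancel₀ h (by linear_combination hz))
  rcases key x hx with rfl | rfl <;> rcases key y hy with rfl | rfl <;>
    simp [sgn, CharTwo.add_self_eq_zero]

theorem pow_two_pow_mul_eq {F : Type*} [Field F] {k : ℕ} {x : F} (hx : x ^ 2 ^ k = x) (d : ℕ) :
    x ^ 2 ^ (k * d) = x := by
  induction d with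
  | zero => simp
  | succ d ih => rw [mul_add, pow_add, pow_mul, ih, mul_one, hx]

theorem absTr_relTr {F : Type*} [Field F] [CharP F 2] {m d : ℕ} (hm : 0 < m) (x : F) :
    absTr (m * d) x = absTr m (relTr (m * d) m x) := by
  unfold relTr
  rw [Nat.mul_div_cancel_left _ hm]
  induction d with
  | zero => simp [absTr]
  | succ d ih =>
    rw [Finset.sum_range_succ, absTr_add, ← ih]
    simp only [absTr, mul_add, mul_one, Finset.sum_range_add, ← pow_mul, ← pow_add]

theorem relTr_mul_left {F : Type*} [Field F] (k : ℕ) {m : ℕ} {y : F} (hy : y ^ 2 ^ m = y)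
    (x : F) : relTr k m (x * y) = relTr k m x * y := by
  simp [relTr, mul_pow, pow_two_pow_mul_eq hy, Finset.sum_mul]

theorem relTr_pow {F : Type*} [Field F] [CharP F 2] {m d : ℕ} (hm : 0 < m) {x : F}
    (hx : x ^ 2 ^ (m * d) = x) : relTr (m * d) m x ^ 2 ^ m = relTr (m * d) m x := by
  unfold relTr
  rw [Nat.mul_div_cancel_left _ hm, sum_pow_char_pow]
  have h := Finset.sum_range_succ' (fun i => x ^ 2 ^ (m * i)) d
  rw [Finset.sum_range_succ, hx, mul_zero, pow_zero, pow_one] at h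
  simpa [← pow_mul, ← pow_add, mul_add] using (add_right_cancel h).symm

/-- The `k`-th roots of unity of a finite field, as a finset. -/
def unityRoots (F : Type*) [Field F] [Fintype F] (k : ℕ) : Finset F :=
  Finset.univ.filter fun x => x ^ k = 1

theorem mem_unityRoots {F : Type*} [Field F] [Fintype F] {k : ℕ} {x : F} :
    x ∈ unityRoots F k ↔ x ^ k = 1 := by
  simp [unityRoots]

theorem mem_gf {F : Type*} [Field F] [Fintype F] {k : ℕ} {x : F} :
    x ∈ gf F k ↔ x ^ 2 ^ k = x := by
  simp [gf]

theorem card_unityRoots_le {F : Type*} [Field F] [Fintype F] {k : ℕ} (hk : 0 < k) :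
    (unityRoots F k).card ≤ k := by
  have h : unityRoots F k ⊆ Polynomial.nthRootsFinset k (1 : F) := fun x hx => by
    rw [Polynomial.mem_nthRootsFinset hk]
    exact mem_unityRoots.1 hx
  refine (Finset.card_le_card h).trans ?_
  rw [Polynomial.nthRootsFinset_def]
  exact (Multiset.toFinset_card_le _).trans (Polynomial.card_nthRoots _ _)

theorem eq_one_of_pow_eq_one {F : Type*} [Field F] {A B : ℕ} (hAB : A.Coprime B) {x : F}
    (hA : x ^ A = 1) (hB : x ^ B = 1) : x = 1 := by
  simpa [hAB.gcd_eq_one] using pow_gcd_eq_one.2 ⟨hA, hB⟩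

theorem exists_mul_of_pow_mul_eq_one {F : Type*} [Field F] {A B : ℕ} (hAB : A.Coprime B)
    {x : F} (hx0 : x ≠ 0) (hx : x ^ (A * B) = 1) :
    ∃ u y : F, u ^ A = 1 ∧ y ^ B = 1 ∧ x = u * y := by
  refine ⟨(x ^ B) ^ (A.gcdB B), (x ^ A) ^ (A.gcdA B), ?_, ?_, ?_⟩
  · rw [← zpow_natCast, zpow_comm, zpow_natCast, ← pow_mul, mul_comm, hx, one_zpow]
  · rw [← zpow_natCast, zpow_comm, zpow_natCast, ← pow_mul, hx, one_zpow]
  · have h := Nat.gcd_eq_gcd_ab A B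
    rw [hAB.gcd_eq_one] at h
    rw [← zpow_natCast, ← zpow_natCast, ← zpow_mul, ← zpow_mul, ← zpow_add₀ hx0, add_comm, ← h]
    simp

theorem sum_unityRoots_mul {F : Type*} [Field F] [Fintype F] {A B : ℕ} (hA : 0 < A) (hB : 0 < B)
    (hAB : A.Coprime B) (hF : Fintype.card F = A * B + 1) (H : F → ℤ) :
    ∑ x ∈ Finset.univ.erase (0 : F), H x =
      ∑ u ∈ unityRoots F A, ∑ y ∈ unityRoots F B, H (u * y) := by
  rw [← Finset.sum_product']
  symm
  have ne0 : ∀ {k : ℕ} {x : F}, 0 < k → x ^ k = 1 → x ≠ 0 := by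
    rintro k x hk hx rfl
    simp [hk.ne'] at hx
  refine Finset.sum_nbij (fun p => p.1 * p.2) ?_ ?_ ?_ (fun _ _ => rfl)
  · rintro ⟨u, y⟩ h
    simp only [Finset.mem_product, mem_unityRoots] at h
    simpa using ⟨ne0 hA h.1, ne0 hB h.2⟩
  · rintro ⟨u, y⟩ h ⟨u', y'⟩ h' e
    simp only [Finset.coe_product, Set.mem_prod, Finset.mem_coe, mem_unityRoots] at h h' e
    have hu' := ne0 hA h'.1
    have hy := ne0 hB h.2
    have e2 : u / u' = y' / y := by
      rw [div_eq_div_iff hu' hy, e, mul_comm]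
    have e3 : u / u' = 1 := by
      refine eq_one_of_pow_eq_one hAB ?_ ?_
      · rw [div_pow, h.1, h'.1, div_one]
      · rw [e2, div_pow, h.2, h'.2, div_one]
    have e4 : y' / y = 1 := e2 ▸ e3
    rw [div_eq_one_iff_eq hu'] at e3
    rw [div_eq_one_iff_eq hy] at e4
    rw [e3, e4]
  · intro x hx
    have hx0 : x ≠ 0 := by simpa using hx
    have h1 : x ^ (A * B) = 1 := by
      have := FiniteField.pow_card_sub_one_eq_one x hx0
      rwa [hF, Nat.add_sub_cancel] at this
    obtain ⟨u, y, hu, hy, e⟩ := exists_mul_of_pow_mul_eq_one hAB hx0 h1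
    refine ⟨(u, y), ?_, e.symm⟩
    simp [mem_unityRoots, hu, hy]

theorem card_unityRoots_of_coprime {F : Type*} [Field F] [Fintype F] {A B : ℕ} (hA : 0 < A)
    (hB : 0 < B) (hAB : A.Coprime B) (hF : Fintype.card F = A * B + 1) :
    (unityRoots F A).card = A ∧ (unityRoots F B).card = B := by
  have h := sum_unityRoots_mul hA hB hAB hF (fun _ => 1)
  have h1 : (Finset.univ.erase (0 : F)).card = A * B := by
    rw [Finset.card_erase_of_mem (Finset.mem_univ _), Finset.card_univ, hF, Nat.add_sub_cancel]
  simp only [Finset.sum_const, h1, nsmul_eq_mul, mul_one] at h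
  norm_cast at h
  have hA' := card_unityRoots_le (F := F) hA
  have hB' := card_unityRoots_le (F := F) hB
  constructor <;> nlinarith

theorem gf_eq_insert {F : Type*} [Field F] [Fintype F] (k : ℕ) :
    gf F k = insert 0 (unityRoots F (2 ^ k - 1)) := by
  ext x
  have h : 2 ^ k = 2 ^ k - 1 + 1 := (Nat.sub_add_cancel Nat.one_le_two_pow).symm
  rw [mem_gf, Finset.mem_insert, mem_unityRoots]
  rcases eq_or_ne x 0 with rfl | hx
  · simp
  · rw [h, pow_succ]
    simp [hx]

theorem zero_notMem_unityRoots {F : Type*} [Field F] [Fintype F] {k : ℕ} (hk : 0 < k) :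
    (0 : F) ∉ unityRoots F k := by
  simp [mem_unityRoots, hk.ne']

theorem exists_absTr_ne_zero {F : Type*} [Field F] [Fintype F] {k : ℕ} (hk : 0 < k)
    (hc : (gf F k).card = 2 ^ k) : ∃ y ∈ gf F k, absTr k y ≠ 0 := by
  by_contra! h
  let p : Polynomial F := ∑ i ∈ Finset.range k, Polynomial.X ^ 2 ^ i
  have hcoeff : p.coeff 1 = 1 := by
    simp only [p, Polynomial.finsetSum_coeff, Polynomial.coeff_X_pow]
    rw [Finset.sum_eq_single 0]
    · simp
    · intro i _ hi
      rw [if_neg]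
      exact (Nat.one_lt_two_pow hi).ne
    · simp [hk.ne']
  have hp : p ≠ 0 := by
    intro h0
    simp [h0] at hcoeff
  have hdeg : p.natDegree ≤ 2 ^ (k - 1) := by
    refine Polynomial.natDegree_sum_le_of_forall_le _ _ fun i hi => ?_
    rw [Polynomial.natDegree_X_pow]
    have := Finset.mem_range.1 hi
    exact Nat.pow_le_pow_right (by norm_num) (by lia)
  have hsub : (gf F k).val ⊆ p.roots := fun y hy => by
    rw [Polynomial.mem_roots hp, Polynomial.IsRoot.def]
    simpa [p, Polynomial.eval_finsetSum, absTr] using h y hy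
  have h1 := Multiset.card_le_card ((Multiset.le_iff_subset (gf F k).nodup).2 hsub)
  have h2 := p.card_roots'
  have h3 : 2 ^ (k - 1) < 2 ^ k := Nat.pow_lt_pow_right (by norm_num) (by lia)
  rw [Finset.card_val, hc] at h1
  lia

theorem sum_gf_sgn_absTr {F : Type*} [Field F] [Fintype F] [CharP F 2] {k : ℕ} (hk : 0 < k)
    (hc : (gf F k).card = 2 ^ k) {c : F} (hcF : c ∈ gf F k) :
    ∑ y ∈ gf F k, sgn (absTr k (c * y)) = if c = 0 then 2 ^ k else 0 := by
  split_ifs with h0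
  · simp [h0, absTr, sgn, hc]
  · obtain ⟨y0, hy0, hne⟩ := exists_absTr_ne_zero hk hc
    rw [mem_gf] at hcF hy0
    have key : ∑ y ∈ gf F k, sgn (absTr k (c * y)) =
        ∑ y ∈ gf F k, -sgn (absTr k (c * y)) := by
      refine Finset.sum_nbij' (fun y => y + y0 / c) (fun y => y + y0 / c) ?_ ?_ ?_ ?_ ?_
      · intro y hy
        rw [mem_gf] at hy ⊢
        rw [add_pow_char_pow, div_pow, hy, hy0, hcF]
      · intro y hy
        rw [mem_gf] at hy ⊢
        rw [add_pow_char_pow, div_pow, hy, hy0, hcF]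
      · intro y _
        rw [add_assoc, CharTwo.add_self_eq_zero, add_zero]
      · intro y _
        rw [add_assoc, CharTwo.add_self_eq_zero, add_zero]
      · intro y hy
        rw [mem_gf] at hy
        rw [mul_add, mul_div_cancel₀ _ h0, absTr_add, sgn_add_of_sq_eq]
        · simp [sgn, hne]
        · exact absTr_sq k (by rw [mul_pow, hcF, hy])
        · exact absTr_sq k hy0
    rw [Finset.sum_neg_distrib] at key
    lia

theorem sum_comp_of_mapsTo_of_injOn {α : Type*} {s : Finset α} {g : α → α}
    (hg : ∀ x ∈ s, g x ∈ s) (hinj : Set.InjOn g s) (φ : α → ℤ) :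
    ∑ x ∈ s, φ (g x) = ∑ x ∈ s, φ x :=
  Finset.sum_nbij g hg hinj (Finset.surjOn_of_injOn_of_card_le g hg hinj le_rfl) fun _ _ => rfl

theorem coprime_two_pow_add_one_sub_one {k : ℕ} (hk : 0 < k) :
    (2 ^ k + 1).Coprime (2 ^ k - 1) := by
  have h1 : 2 ^ k + 1 = (2 ^ k - 1) + 2 := by
    have := Nat.one_le_two_pow (n := k)
    lia
  rw [h1, Nat.coprime_self_add_left, Nat.coprime_two_left]
  exact Nat.Even.sub_odd Nat.one_le_two_pow (Nat.even_pow.2 ⟨even_two, hk.ne'⟩) odd_one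

theorem two_pow_mul_two (k : ℕ) : 2 ^ (k * 2) = (2 ^ k + 1) * (2 ^ k - 1) + 1 := by
  have := Nat.one_le_two_pow (n := k)
  zify [this]
  ring

theorem two_pow_sub_one_pos {k : ℕ} (hk : 0 < k) : 0 < 2 ^ k - 1 := by
  have := Nat.one_lt_two_pow hk.ne'
  lia

theorem card_gf_of_coprime {F : Type*} [Field F] [Fintype F] {A k : ℕ} (hA : 0 < A) (hk : 0 < k)
    (hAk : A.Coprime (2 ^ k - 1)) (hF : Fintype.card F = A * (2 ^ k - 1) + 1) :
    (gf F k).card = 2 ^ k := by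
  have hB := two_pow_sub_one_pos hk
  rw [gf_eq_insert, Finset.card_insert_of_notMem (zero_notMem_unityRoots hB),
    (card_unityRoots_of_coprime hA hB hAk hF).2]
  lia

theorem add_inv_fibre_card {F : Type*} [Field F] [Fintype F] [CharP F 2] {A B : ℕ}
    (hA : 0 < A) (hB : 0 < B) (hAB : A.Coprime B) (t : F) :
    ((unityRoots F B).filter fun v => v + v⁻¹ = t).card +
      ((unityRoots F A).filter fun v => v + v⁻¹ = t).card ≤ 2 := by
  have ne0 : ∀ {k : ℕ} {x : F}, 0 < k → x ∈ unityRoots F k → x ≠ 0 := by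
    rintro k x hk hx rfl
    exact zero_notMem_unityRoots hk hx
  rcases eq_or_ne t 0 with rfl | ht
  · have key : ∀ k, 0 < k → ((unityRoots F k).filter fun v => v + v⁻¹ = 0).card ≤ 1 := by
      intro k hk
      refine Finset.card_le_one.2 fun x hx y hy => ?_
      have one : ∀ z : F, z ∈ (unityRoots F k).filter (fun v => v + v⁻¹ = 0) → z = 1 := by
        intro z hz
        obtain ⟨hz, e⟩ := Finset.mem_filter.1 hz
        have e1 : z ^ 2 = 1 ^ 2 := by
          have hz0 := ne0 hk hz
          field_simp at e
          rw [one_pow]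
          exact CharTwo.add_eq_zero.1 (by simpa using e)
        exact CharTwo.sq_injective e1
      rw [one x hx, one y hy]
    exact add_le_add (key B hB) (key A hA)
  · rw [← Finset.card_union_of_disjoint]
    · rcases Finset.eq_empty_or_nonempty
        (((unityRoots F B).filter fun v => v + v⁻¹ = t) ∪
          ((unityRoots F A).filter fun v => v + v⁻¹ = t)) with h | ⟨v, hv⟩
      · simp [h]
      · have prop : ∀ z ∈ ((unityRoots F B).filter fun v => v + v⁻¹ = t) ∪
            ((unityRoots F A).filter fun v => v + v⁻¹ = t), z ≠ 0 ∧ z + z⁻¹ = t := by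
          intro z hz
          rw [Finset.mem_union, Finset.mem_filter, Finset.mem_filter] at hz
          rcases hz with hz | hz
          · exact ⟨ne0 hB hz.1, hz.2⟩
          · exact ⟨ne0 hA hz.1, hz.2⟩
        refine le_trans (Finset.card_le_card (t := {v, v⁻¹}) fun z hz => ?_) Finset.card_le_two
        obtain ⟨hz0, hz⟩ := prop z hz
        obtain ⟨hv0, hv⟩ := prop v hv
        have e : (z - v) * (z * v - 1) = 0 := by
          have e1 : z + z⁻¹ = v + v⁻¹ := hz.trans hv.symm
          field_simp at e1
          linear_combination e1
        rw [Finset.mem_insert, Finset.mem_singleton]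
        rcases mul_eq_zero.1 e with e | e
        · exact Or.inl (sub_eq_zero.1 e)
        · exact Or.inr (eq_inv_of_mul_eq_one_left (sub_eq_zero.1 e))
    · rw [Finset.disjoint_left]
      intro z hz hz'
      obtain ⟨h1, e⟩ := Finset.mem_filter.1 hz
      have h2 := (Finset.mem_filter.1 hz').1
      have := eq_one_of_pow_eq_one hAB (mem_unityRoots.1 h2) (mem_unityRoots.1 h1)
      rw [this, inv_one, CharTwo.add_self_eq_zero] at e
      exact ht e.symm

theorem pow_eq_inv_of_mem_unityRoots {F : Type*} [Field F] [Fintype F] {k : ℕ} {u : F}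
    (hu : u ∈ unityRoots F (k + 1)) : u ^ k = u⁻¹ := by
  rw [mem_unityRoots, pow_succ] at hu
  exact eq_inv_of_mul_eq_one_left hu

theorem mem_gf_of_mem_unityRoots {F : Type*} [Field F] [Fintype F] {k : ℕ} {v : F}
    (hv : v ∈ unityRoots F (2 ^ k - 1)) : v ^ 2 ^ k = v := by
  rw [← mem_gf, gf_eq_insert]
  exact Finset.mem_insert_of_mem hv

theorem sum_add_inv {F : Type*} [Field F] [Fintype F] [CharP F 2] {k : ℕ} (hk : 0 < k)
    (hF : Fintype.card F = 2 ^ (k * 2)) (φ : F → ℤ) :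
    ∑ v ∈ unityRoots F (2 ^ k - 1), φ (v + v⁻¹) + ∑ u ∈ unityRoots F (2 ^ k + 1), φ (u + u⁻¹) =
      2 * ∑ t ∈ gf F k, φ t := by
  have hB := two_pow_sub_one_pos hk
  have hA : 0 < 2 ^ k + 1 := Nat.succ_pos _
  have hAB := coprime_two_pow_add_one_sub_one hk
  rw [two_pow_mul_two] at hF
  have hmB : ∀ v ∈ unityRoots F (2 ^ k - 1), v + v⁻¹ ∈ gf F k := fun v hv => by
    rw [mem_gf, add_pow_char_pow, inv_pow, mem_gf_of_mem_unityRoots hv]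
  have hmA : ∀ u ∈ unityRoots F (2 ^ k + 1), u + u⁻¹ ∈ gf F k := fun u hu => by
    rw [mem_gf, add_pow_char_pow, inv_pow, pow_eq_inv_of_mem_unityRoots hu, inv_inv, add_comm]
  have hcount : ∀ t ∈ gf F k,
      ((unityRoots F (2 ^ k - 1)).filter fun v => v + v⁻¹ = t).card +
        ((unityRoots F (2 ^ k + 1)).filter fun v => v + v⁻¹ = t).card = 2 := by
    rw [← Finset.sum_eq_sum_iff_of_le fun t _ => add_inv_fibre_card hA hB hAB t,
      Finset.sum_add_distrib, ← Finset.card_eq_sum_card_fiberwise hmB,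
      ← Finset.card_eq_sum_card_fiberwise hmA, Finset.sum_const,
      card_gf_of_coprime hA hk hAB hF, (card_unityRoots_of_coprime hA hB hAB hF).1,
      (card_unityRoots_of_coprime hA hB hAB hF).2, smul_eq_mul]
    lia
  have hfib : ∀ s : Finset F, (∀ v ∈ s, v + v⁻¹ ∈ gf F k) → ∑ v ∈ s, φ (v + v⁻¹) =
      ∑ t ∈ gf F k, ((s.filter fun v => v + v⁻¹ = t).card : ℤ) * φ t := by
    intro s hs
    rw [← Finset.sum_fiberwise_of_maps_to hs]
    refine Finset.sum_congr rfl fun t _ => ?_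
    rw [Finset.sum_congr rfl fun v hv => by rw [(Finset.mem_filter.1 hv).2], Finset.sum_const,
      nsmul_eq_mul]
  rw [hfib _ hmB, hfib _ hmA, ← Finset.sum_add_distrib, Finset.mul_sum]
  refine Finset.sum_congr rfl fun t ht => ?_
  rw [← add_mul, ← Nat.cast_add, hcount t ht, Nat.cast_ofNat]

theorem kloo_eq_one_add_sum {F : Type*} [Field F] [Fintype F] [CharP F 2] {k : ℕ} (hk : 0 < k)
    {a : F} (ha : a ^ 2 ^ k = a) (ha0 : a ≠ 0) :
    kloo k a = 1 + ∑ v ∈ unityRoots F (2 ^ k - 1), sgn (absTr k (a * (v + v⁻¹))) := by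
  have hB := two_pow_sub_one_pos hk
  have haR : a ^ (2 ^ k - 1) = 1 := by
    have h : a ∈ gf F k := mem_gf.2 ha
    rw [gf_eq_insert, Finset.mem_insert, mem_unityRoots] at h
    exact h.resolve_left ha0
  unfold kloo
  rw [gf_eq_insert, Finset.sum_insert (zero_notMem_unityRoots hB)]
  congr 1
  · simp [absTr, sgn]
  · rw [← sum_comp_of_mapsTo_of_injOn (g := fun x => a * x ^ 2)
      (φ := fun v => sgn (absTr k (a * (v + v⁻¹))))]
    · refine Finset.sum_congr rfl fun x hx => ?_
      have hx0 : x ≠ 0 := fun h => zero_notMem_unityRoots hB (h ▸ hx)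
      have hx' := mem_gf_of_mem_unityRoots hx
      rw [← absTr_pow_two]
      · congr 2
        rw [CharTwo.add_sq]
        field_simp
      · rw [add_pow_char_pow, inv_pow, mul_pow, ha, hx']
    · intro x hx
      rw [mem_unityRoots] at hx ⊢
      rw [mul_pow, haR, ← pow_mul, mul_comm 2, pow_mul, hx, one_pow, one_mul]
    · intro x _ y _ h
      exact CharTwo.sq_injective (mul_left_cancel₀ ha0 h)

theorem sum_unityRoots_eq_one_sub_kloo {F : Type*} [Field F] [Fintype F] [CharP F 2] {k : ℕ}
    (hk : 0 < k) (hF : Fintype.card F = 2 ^ (k * 2)) {a : F} (ha : a ^ 2 ^ k = a) (ha0 : a ≠ 0) :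
    ∑ u ∈ unityRoots F (2 ^ k + 1), sgn (absTr (k * 2) (a * u)) = 1 - kloo k a := by
  have hF' := hF
  rw [two_pow_mul_two] at hF'
  have h := sum_add_inv hk hF (fun t => sgn (absTr k (a * t)))
  rw [sum_gf_sgn_absTr hk (card_gf_of_coprime (Nat.succ_pos _) hk
    (coprime_two_pow_add_one_sub_one hk) hF') (mem_gf.2 ha), if_neg ha0, mul_zero] at h
  rw [kloo_eq_one_add_sum hk ha ha0]
  have e : ∑ u ∈ unityRoots F (2 ^ k + 1), sgn (absTr (k * 2) (a * u)) =
      ∑ u ∈ unityRoots F (2 ^ k + 1), sgn (absTr k (a * (u + u⁻¹))) := by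
    refine Finset.sum_congr rfl fun u hu => ?_
    rw [absTr_relTr hk, mul_add]
    congr 2
    unfold relTr
    rw [Nat.mul_div_cancel_left _ hk, Finset.sum_range_succ, Finset.sum_range_one, mul_zero,
      pow_zero, pow_one, mul_one, mul_pow, ha, pow_eq_inv_of_mem_unityRoots hu]
  rw [e]
  linarith

theorem sum_sgn_fA {F : Type*} [Field F] [Fintype F] [CharP F 2] {k : ℕ}
    (hk : 0 < k) (hF : Fintype.card F = 2 ^ (k * 2)) {a : F} (ha : a ^ 2 ^ k = a) (ha0 : a ≠ 0) :
    ∑ x ∈ Finset.univ.erase (0 : F), sgn (fA (k * 2) k a x) =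
      (2 ^ k - 1) * (1 - kloo k a) := by
  have hB := two_pow_sub_one_pos hk
  have hA : 0 < 2 ^ k + 1 := Nat.succ_pos _
  have hAB := coprime_two_pow_add_one_sub_one hk
  have hF' := hF
  rw [two_pow_mul_two] at hF'
  rw [sum_unityRoots_mul hA hB hAB hF', ← sum_unityRoots_eq_one_sub_kloo hk hF ha ha0,
    ← sum_comp_of_mapsTo_of_injOn (g := fun x => x ^ (2 ^ k - 1))
      (φ := fun u => sgn (absTr (k * 2) (a * u))), Finset.mul_sum]
  · refine Finset.sum_congr rfl fun u _ => ?_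
    have : ∀ y ∈ unityRoots F (2 ^ k - 1), sgn (fA (k * 2) k a (u * y)) =
        sgn (absTr (k * 2) (a * u ^ (2 ^ k - 1))) := fun y hy => by
      rw [fA, mul_pow, mem_unityRoots.1 hy, mul_one]
    rw [Finset.sum_congr rfl this, Finset.sum_const,
      (card_unityRoots_of_coprime hA hB hAB hF').2, nsmul_eq_mul,
      Nat.cast_sub Nat.one_le_two_pow]
    norm_num
  · intro x hx
    rw [mem_unityRoots] at hx ⊢
    rw [← pow_mul, mul_comm, pow_mul, hx, one_pow]
  · intro x hx y hy h
    have hy0 : y ≠ 0 := fun h0 => zero_notMem_unityRoots hA (h0 ▸ hy)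
    rw [Finset.mem_coe, mem_unityRoots] at hx hy
    rw [← div_eq_one_iff_eq hy0]
    refine eq_one_of_pow_eq_one hAB ?_ ?_
    · rw [div_pow, hx, hy, div_one]
    · rw [div_pow, div_eq_one_iff_eq (pow_ne_zero _ hy0)]
      exact h

theorem three_dvd_two_pow_add_one {m : ℕ} (hm : Odd m) : 3 ∣ 2 ^ m + 1 := by
  simpa using hm.nat_add_dvd_pow_add_pow 2 1

theorem prod_two_pow_add_one_mul (ν m : ℕ) :
    (∏ i ∈ Finset.range ν, (2 ^ (2 ^ i * m) + 1)) * (2 ^ m - 1) = 2 ^ (2 ^ ν * m) - 1 := by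
  induction ν with
  | zero => simp
  | succ ν ih =>
    rw [Finset.prod_range_succ, mul_right_comm, ih, pow_succ, mul_right_comm, two_pow_mul_two,
      Nat.add_sub_cancel, mul_comm]

theorem coprime_prod_two_pow_add_one (ν : ℕ) {m : ℕ} (hm : 0 < m) :
    (∏ i ∈ Finset.range ν, (2 ^ (2 ^ i * m) + 1)).Coprime (2 ^ m - 1) := by
  refine Nat.Coprime.prod_left fun i _ => ?_
  refine (coprime_two_pow_add_one_sub_one (Nat.mul_pos (by positivity) hm)).coprime_dvd_right ?_
  exact Nat.pow_sub_one_dvd_pow_sub_one 2 (Dvd.intro_left _ rfl)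

theorem exists_prod_of_pow_eq_one {F : Type*} [Field F] {m : ℕ} (hm : 0 < m) (ν : ℕ) {u : F}
    (hu : u ^ (∏ i ∈ Finset.range ν, (2 ^ (2 ^ i * m) + 1)) = 1) :
    ∃ c : Fin ν → F,
      (∀ i : Fin ν, c i ^ (2 ^ (2 ^ (ν - 1 - (i : ℕ)) * m) + 1) = 1) ∧ u = ∏ i, c i := by
  induction ν generalizing u with
  | zero => exact ⟨fun _ => 1, fun i => i.elim0, by simpa using hu⟩
  | succ ν ih =>
    have hu0 : u ≠ 0 := by
      rintro rfl
      rw [zero_pow] at hu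
      · exact zero_ne_one hu
      · exact Finset.prod_ne_zero_iff.2 fun _ _ => Nat.succ_ne_zero _
    rw [Finset.prod_range_succ, mul_comm] at hu
    have hcop : (2 ^ (2 ^ ν * m) + 1).Coprime
        (∏ i ∈ Finset.range ν, (2 ^ (2 ^ i * m) + 1)) :=
      (coprime_two_pow_add_one_sub_one (Nat.mul_pos (by positivity) hm)).coprime_dvd_right
        (Dvd.intro _ (prod_two_pow_add_one_mul ν m))
    obtain ⟨c₀, y, hc₀, hy, rfl⟩ := exists_mul_of_pow_mul_eq_one hcop hu0 hu
    obtain ⟨c, hc, rfl⟩ := ih hy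
    refine ⟨Fin.cons c₀ c, fun i => ?_, by rw [Fin.prod_cons]⟩
    refine Fin.cases ?_ (fun j => ?_) i
    · simpa using hc₀
    · have e : ν + 1 - 1 - ((j.succ : Fin (ν + 1)) : ℕ) = ν - 1 - (j : ℕ) := by
        rw [Fin.val_succ]
        lia
      rw [Fin.cons_succ, e]
      exact hc j

theorem bigU_eq_unityRoots {F : Type*} [Field F] [Fintype F] (ν : ℕ) {m : ℕ} (hm : 0 < m) :
    bigU F ν m = unityRoots F (∏ i ∈ Finset.range ν, (2 ^ (2 ^ i * m) + 1)) := by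
  ext u
  rw [mem_unityRoots, bigU, Finset.mem_filter]
  refine ⟨?_, fun hu => ⟨Finset.mem_univ _, exists_prod_of_pow_eq_one hm ν hu⟩⟩
  rintro ⟨-, c, hc, rfl⟩
  rw [← Finset.prod_pow]
  refine Finset.prod_eq_one fun i _ => ?_
  have hdvd := Finset.dvd_prod_of_mem (fun i => 2 ^ (2 ^ i * m) + 1)
    (Finset.mem_range.2 (show ν - 1 - (i : ℕ) < ν by have := i.2; lia))
  obtain ⟨d, hd⟩ := hdvd
  rw [hd, pow_mul, hc i, one_pow]

theorem sgn_tr2_add {F : Type*} [Field F] [CharP F 2] {c w : F} (hc : c ^ 3 = 1)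
    (hw : w ^ 3 = 1) (hw1 : w ≠ 1) :
    sgn (tr2 c) + sgn (tr2 (c * w)) + sgn (tr2 (c * w ^ 2)) = -1 := by
  have h2 : (2 : F) = 0 := CharTwo.two_eq_zero
  have hq : w ^ 2 + w + 1 = 0 := by
    have : (w - 1) * (w ^ 2 + w + 1) = 0 := by linear_combination hw
    exact (mul_eq_zero.1 this).resolve_left (sub_ne_zero.2 hw1)
  have hprod : (c - 1) * ((c - w) * (c - w ^ 2)) = 0 := by
    linear_combination hc - (c ^ 2 - c * w) * hq - hw
  have t1 : tr2 (1 : F) = 0 := by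
    rw [tr2]
    linear_combination h2
  have tw : tr2 w = 1 := by
    rw [tr2]
    linear_combination hq - h2
  have tw2 : tr2 (w ^ 2) = 1 := by
    rw [tr2]
    linear_combination hq - h2 + w * hw
  have e4 : w * w = w ^ 2 := by ring
  have e5 : w * w ^ 2 = 1 := by linear_combination hw
  have e6 : w ^ 2 * w = 1 := by linear_combination hw
  have e7 : w ^ 2 * w ^ 2 = w := by linear_combination w * hw
  rcases mul_eq_zero.1 hprod with h | h
  · rw [sub_eq_zero.1 h, one_mul, one_mul, t1, tw, tw2]
    simp [sgn]
  · rcases mul_eq_zero.1 h with h | h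
    · rw [sub_eq_zero.1 h, e4, e5, t1, tw, tw2]
      simp [sgn]
    · rw [sub_eq_zero.1 h, e6, e7, t1, tw, tw2]
      simp [sgn]

theorem tr2_sq {F : Type*} [Field F] [CharP F 2] {c : F} (hc : c ^ 3 = 1) :
    tr2 c ^ 2 = tr2 c := by
  rw [tr2, CharTwo.add_sq]
  linear_combination c * hc

theorem exists_mem_unityRoots_chi_ne_one {F : Type*} [Field F] [Fintype F] {k : ℕ}
    (hk : 0 < k) (hk2 : Even k) (hF : Fintype.card F = 2 ^ (k * 2)) :
    ∃ γ ∈ unityRoots F (2 ^ k - 1), chi (k * 2) γ ≠ 1 := by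
  by_contra! h
  have hB := two_pow_sub_one_pos hk
  have hF' := hF
  rw [two_pow_mul_two] at hF'
  obtain ⟨d, hd⟩ : 3 ∣ 2 ^ k - 1 := by
    simpa using Nat.pow_sub_one_dvd_pow_sub_one 2 hk2.two_dvd
  have hcard := (card_unityRoots_of_coprime (Nat.succ_pos _) hB
    (coprime_two_pow_add_one_sub_one hk) hF').2
  have hsub : unityRoots F (2 ^ k - 1) ⊆ unityRoots F (2 * d) := fun γ hγ => by
    have h1 := h γ hγ
    have e : (2 ^ (k * 2) - 1) / 3 = (2 ^ k - 1) * d + 2 * d := by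
      rw [two_pow_mul_two, Nat.add_sub_cancel]
      have e2 : 2 ^ k + 1 = (2 ^ k - 1) + 2 := by lia
      rw [e2]
      generalize 2 ^ k - 1 = B at hd
      subst hd
      exact Nat.div_eq_of_eq_mul_left (by norm_num) (by ring)
    rw [chi, e, pow_add, pow_mul, mem_unityRoots.1 hγ, one_pow, one_mul] at h1
    exact mem_unityRoots.2 h1
  have := (Finset.card_le_card hsub).trans (card_unityRoots_le (by lia))
  lia

theorem chi_pow_three {F : Type*} [Field F] [Fintype F] {n : ℕ} (hF : Fintype.card F = 2 ^ n)
    (hn : Even n) {x : F} (hx : x ≠ 0) : chi n x ^ 3 = 1 := by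
  have h3 : 3 ∣ 2 ^ n - 1 := by
    simpa using Nat.pow_sub_one_dvd_pow_sub_one 2 hn.two_dvd
  rw [chi, ← pow_mul, Nat.div_mul_cancel h3, ← hF, FiniteField.pow_card_sub_one_eq_one x hx]

theorem fA_mul_right {F : Type*} [Field F] [Fintype F] (n : ℕ) {k : ℕ} (a x : F) {y : F}
    (hy : y ^ (2 ^ k - 1) = 1) : fA n k a (x * y) = fA n k a x := by
  rw [fA, fA, mul_pow, hy, mul_one]

theorem fA_sq {F : Type*} [Field F] [Fintype F] [CharP F 2] {n : ℕ}
    (hF : Fintype.card F = 2 ^ n) (k : ℕ) (a x : F) : fA n k a x ^ 2 = fA n k a x :=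
  absTr_sq n (hF ▸ FiniteField.pow_card _)

theorem gB_sq {F : Type*} [Field F] [Fintype F] [CharP F 2] {n : ℕ}
    (hF : Fintype.card F = 2 ^ n) (hn : Even n) {b x : F} (hb : b ^ 3 = 1) (hx : x ≠ 0) :
    gB n b x ^ 2 = gB n b x :=
  tr2_sq (by rw [mul_pow, hb, chi_pow_three hF hn hx, one_mul])

theorem sum_sgn_fAB {F : Type*} [Field F] [Fintype F] [CharP F 2] {k : ℕ} (hk : 0 < k)
    (hk2 : Even k) (hF : Fintype.card F = 2 ^ (k * 2)) {a b : F} (ha : a ^ 2 ^ k = a)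
    (ha0 : a ≠ 0) (hb : b ^ 3 = 1) :
    3 * ∑ x ∈ Finset.univ.erase (0 : F), sgn (fAB (k * 2) k a b x) =
      -((2 ^ k - 1) * (1 - kloo k a)) := by
  have hn : Even (k * 2) := even_two.mul_left k
  obtain ⟨γ, hγ, hγ1⟩ := exists_mem_unityRoots_chi_ne_one hk hk2 hF
  have hγ0 : γ ≠ 0 := fun h => zero_notMem_unityRoots (two_pow_sub_one_pos hk) (h ▸ hγ)
  rw [mem_unityRoots] at hγ
  have hshift : ∀ δ : F, δ ≠ 0 →
      ∑ x ∈ Finset.univ.erase (0 : F), sgn (fAB (k * 2) k a b (x * δ)) =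
        ∑ x ∈ Finset.univ.erase (0 : F), sgn (fAB (k * 2) k a b x) := fun δ hδ =>
    sum_comp_of_mapsTo_of_injOn (g := fun x => x * δ)
      (φ := fun x => sgn (fAB (k * 2) k a b x)) (fun x hx => by simpa [hδ] using hx)
      (fun x _ y _ h => mul_right_cancel₀ hδ h)
  rw [← sum_sgn_fA hk hF ha ha0, ← Finset.sum_neg_distrib]
  calc
    _ = ∑ x ∈ Finset.univ.erase (0 : F), (sgn (fAB (k * 2) k a b x) +
          sgn (fAB (k * 2) k a b (x * γ)) + sgn (fAB (k * 2) k a b (x * γ ^ 2))) := by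
      rw [Finset.sum_add_distrib, Finset.sum_add_distrib, hshift γ hγ0,
        hshift _ (pow_ne_zero 2 hγ0)]
      ring
    _ = _ := by
      refine Finset.sum_congr rfl fun x hx => ?_
      have hx0 : x ≠ 0 := Finset.ne_of_mem_erase hx
      have hc : (b * chi (k * 2) x) ^ 3 = 1 := by
        rw [mul_pow, hb, chi_pow_three hF hn hx0, one_mul]
      have hsplit : ∀ z : F, z ≠ 0 → sgn (fAB (k * 2) k a b z) =
          sgn (fA (k * 2) k a z) * sgn (gB (k * 2) b z) := fun z hz =>
        sgn_add_of_sq_eq (fA_sq hF k a z) (gB_sq hF hn hb hz)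
      have hγ2 : (γ ^ 2) ^ (2 ^ k - 1) = 1 := by rw [pow_right_comm, hγ, one_pow]
      have h1 : gB (k * 2) b (x * γ) = tr2 (b * chi (k * 2) x * chi (k * 2) γ) := by
        rw [gB, chi, mul_pow, ← mul_assoc]
        rfl
      have h2 : gB (k * 2) b (x * γ ^ 2) = tr2 (b * chi (k * 2) x * chi (k * 2) γ ^ 2) := by
        rw [gB, chi, mul_pow, ← mul_assoc, pow_right_comm]
        rfl
      rw [hsplit x hx0, hsplit _ (mul_ne_zero hx0 hγ0),
        hsplit _ (mul_ne_zero hx0 (pow_ne_zero 2 hγ0)), fA_mul_right _ _ _ hγ,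
        fA_mul_right _ _ _ hγ2, ← mul_add, ← mul_add, h1, h2, gB,
        sgn_tr2_add hc (chi_pow_three hF hn hγ0) hγ1, mul_neg_one]

/-- For `ν > 1`, `a ∈ F_{2^{m₁}}^*`, `b ∈ F_4^*` and `ω ∈ F_{2^n}^*`:
`3·(2^m − 1)·(W_{f_{a,b}}(ω) − 1 − 2^m·Σ₀) = (2^{2^{ν−1}·m} − 1)·(1 − K_{m₁}(a))`,
where `Σ₀ = ∑_{u ∈ U, Tr^n_m(ω·u) = 0} (−1)^{f_{a,b}(u)}`. -/
theorem walsh_at_nonzero_even_case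
    {F : Type*} [Field F] [Fintype F]
    (n ν m : ℕ) (hν : 1 < ν) (hm : Odd m) (hn : n = 2 ^ ν * m)
    (hF : Fintype.card F = 2 ^ n)
    (a b : F) (ha : a ^ 2 ^ (2 ^ (ν - 1) * m) = a) (ha0 : a ≠ 0)
    (hb : b ^ 3 = 1) (hb0 : b ≠ 0)
    (ω : F) (hω : ω ≠ 0) :
    3 * (2 ^ m - 1) *
        (walsh n (fAB n (2 ^ (ν - 1) * m) a b) ω - 1
          - 2 ^ m * ∑ u ∈ (bigU F ν m).filter (fun u => relTr n m (ω * u) = 0),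
              sgn (fAB n (2 ^ (ν - 1) * m) a b u))
      = (2 ^ (2 ^ (ν - 1) * m) - 1) * (1 - kloo (2 ^ (ν - 1) * m) a) := by
  have hm0 : 0 < m := hm.pos
  have hnm : n = m * 2 ^ ν := hn.trans (mul_comm _ _)
  obtain ⟨k, hkdef⟩ : ∃ k, k = 2 ^ (ν - 1) * m := ⟨_, rfl⟩
  rw [← hkdef] at ha ⊢
  have hnk : n = k * 2 := by
    rw [hn, hkdef, mul_right_comm, ← pow_succ, Nat.sub_add_cancel hν.le]
  have hk0 : 0 < k := hkdef ▸ Nat.mul_pos (by positivity) hm0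
  have hk2 : Even k := hkdef ▸ (even_two.pow_of_ne_zero (by lia)).mul_right m
  have hneven : Even n := hnk ▸ even_two.mul_left k
  have : CharP F 2 := charP_of_card_eq_prime_pow hF
  have hfrob : ∀ x : F, x ^ 2 ^ n = x := fun x => hF ▸ FiniteField.pow_card x
  obtain ⟨P, hP⟩ : ∃ P, P = ∏ i ∈ Finset.range ν, (2 ^ (2 ^ i * m) + 1) := ⟨_, rfl⟩
  have hP0 : 0 < P := hP ▸ Finset.prod_pos fun _ _ => Nat.succ_pos _
  have hPmul : P * (2 ^ m - 1) = 2 ^ n - 1 := by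
    rw [hP, prod_two_pow_add_one_mul, hn]
  have hcop : P.Coprime (2 ^ m - 1) := hP ▸ coprime_prod_two_pow_add_one ν hm0
  have hF' : Fintype.card F = P * (2 ^ m - 1) + 1 := by
    rw [hF, hPmul, Nat.sub_add_cancel Nat.one_le_two_pow]
  have hB := two_pow_sub_one_pos hm0
  have h3P : 3 ∣ P := by
    rw [hP]
    refine (three_dvd_two_pow_add_one hm).trans ?_
    simpa using Finset.dvd_prod_of_mem (fun i => 2 ^ (2 ^ i * m) + 1)
      (Finset.mem_range.2 (show 0 < ν by lia))
  have hinv : ∀ (u : F), ∀ y ∈ unityRoots F (2 ^ m - 1),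
      fAB n k a b (u * y) = fAB n k a b u := by
    intro u y hy
    rw [mem_unityRoots] at hy
    have hyk : y ^ (2 ^ k - 1) = 1 := by
      obtain ⟨d, hd⟩ := Nat.pow_sub_one_dvd_pow_sub_one 2 (hkdef ▸ Dvd.intro_left _ rfl : m ∣ k)
      rw [hd, pow_mul, hy, one_pow]
    have hyχ : y ^ ((2 ^ n - 1) / 3) = 1 := by
      obtain ⟨d, hd⟩ := h3P
      rw [← hPmul, hd, mul_assoc, Nat.mul_div_cancel_left _ (by norm_num), mul_comm, pow_mul, hy,
        one_pow]
    rw [fAB, fAB, fA_mul_right _ _ _ hyk, gB, gB, chi, chi, mul_pow, hyχ, mul_one]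
  have hsq : ∀ x : F, x ≠ 0 → fAB n k a b x ^ 2 = fAB n k a b x := fun x hx => by
    rw [fAB, CharTwo.add_sq, fA_sq hF, gB_sq hF hneven hb hx]
  have hzero : fAB n k a b 0 = 0 := by
    have hdiv : (2 ^ n - 1) / 3 ≠ 0 := by
      obtain ⟨d, hd⟩ := h3P
      rw [← hPmul, hd, mul_assoc, Nat.mul_div_cancel_left _ (by norm_num)]
      exact mul_ne_zero (by rintro rfl; lia) hB.ne'
    simp [fAB, fA, gB, tr2, chi, absTr, hdiv, (two_pow_sub_one_pos hk0).ne']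
  have hS := sum_sgn_fAB hk0 hk2 (hnk ▸ hF) ha ha0 hb
  rw [← hnk, sum_unityRoots_mul hP0 hB hcop hF'] at hS
  have hconst : ∀ u ∈ unityRoots F P, ∑ y ∈ unityRoots F (2 ^ m - 1), sgn (fAB n k a b (u * y)) =
      (2 ^ m - 1) * sgn (fAB n k a b u) := fun u _ => by
    rw [Finset.sum_congr rfl fun y hy => by rw [hinv u y hy], Finset.sum_const,
      (card_unityRoots_of_coprime hP0 hB hcop hF').2, nsmul_eq_mul,
      Nat.cast_sub Nat.one_le_two_pow]
    norm_num
  rw [Finset.sum_congr rfl hconst, ← Finset.mul_sum] at hS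
  have hinner : ∀ u ∈ unityRoots F P, ∑ y ∈ unityRoots F (2 ^ m - 1),
      sgn (fAB n k a b (u * y) + absTr n (ω * (u * y))) =
        2 ^ m * (if relTr n m (ω * u) = 0 then sgn (fAB n k a b u) else 0) -
          sgn (fAB n k a b u) := by
    intro u hu
    have hu0 : u ≠ 0 := fun h => zero_notMem_unityRoots hP0 (h ▸ hu)
    have hterm : ∀ y ∈ unityRoots F (2 ^ m - 1),
        sgn (fAB n k a b (u * y) + absTr n (ω * (u * y))) =
          sgn (fAB n k a b u) * sgn (absTr m (relTr n m (ω * u) * y)) := by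
      intro y hy
      have htr : absTr n (ω * (u * y)) = absTr m (relTr n m (ω * u) * y) := by
        rw [← mul_assoc, ← relTr_mul_left n (mem_gf_of_mem_unityRoots hy), hnm,
          absTr_relTr hm0]
      rw [hinv u y hy, sgn_add_of_sq_eq (hsq u hu0) (absTr_sq n (hfrob _)), htr]
    have horth := sum_gf_sgn_absTr hm0 (card_gf_of_coprime hP0 hm0 hcop hF')
      (c := relTr n m (ω * u))
      (mem_gf.2 (by rw [hnm]; exact relTr_pow hm0 (hnm ▸ hfrob _)))
    rw [gf_eq_insert, Finset.sum_insert (zero_notMem_unityRoots hB)] at horth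
    have h0 : sgn (absTr m (relTr n m (ω * u) * 0)) = 1 := by simp [absTr, sgn]
    rw [h0] at horth
    rw [Finset.sum_congr rfl hterm, ← Finset.mul_sum, eq_sub_of_add_eq' horth]
    split_ifs <;> ring
  have hW : walsh n (fAB n k a b) ω = 1 + (2 ^ m *
      ∑ u ∈ (bigU F ν m).filter (fun u => relTr n m (ω * u) = 0), sgn (fAB n k a b u) -
        ∑ u ∈ unityRoots F P, sgn (fAB n k a b u)) := by
    rw [walsh, ← Finset.add_sum_erase _ _ (Finset.mem_univ (0 : F)),
      sum_unityRoots_mul hP0 hB hcop hF', Finset.sum_congr rfl hinner, Finset.sum_sub_distrib,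
      ← Finset.mul_sum, bigU_eq_unityRoots ν hm0, ← hP, Finset.sum_filter, hzero]
    congr 1
    simp [absTr, sgn]
  rw [hW]
  linear_combination -hS
end
end

section
/- Let ν = 2 (so n = 4·m_2 with m_2 odd and m_1 = 2·m_2), let a ∈ F_{2^{m_1}}^*, b ∈ F_4^*, and let ω ∈ F_{2^{m_1}}^* have polar decomposition ω = w_2·y in F_{2^{m_1}}^* with w_2 ∈ U_2 and y ∈ F_{2^{m_2}}^*; set γ = b·χ_{m_1}(w_2). Then S_2(a, b, ω) = 2 · ∑_{t ∈ T^1_{m_1}, χ_{m_1}(t) = γ} (−1)^{Tr^{m_1}(a·t)}. -/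
open Finset

attribute [local instance] Classical.propDecidable

noncomputable section

/-- For `ν = 2`, the sum `S_2(a, b, ω) = ∑ (−1)^{f_a(u₁)}`, ranging over pairs
`(u₁, u₂) ∈ U_1 × U_2` such that, with `u = u₁·u₂`, `Tr^n_{m₁}(u·ω) ≠ 0`,
`Tr^n_{m₂}(u·ω) = 0` and `b·χ_n(u₂) = 1`. -/
def S2 {F : Type*} [Field F] [Fintype F] (n m1 m2 : ℕ) (a b ω : F) : ℤ :=
  ∑ p ∈ Finset.univ.filter (fun p : F × F =>
      p.1 ^ (2 ^ m1 + 1) = 1 ∧ p.2 ^ (2 ^ m2 + 1) = 1 ∧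
      relTr n m1 (p.1 * p.2 * ω) ≠ 0 ∧
      relTr n m2 (p.1 * p.2 * ω) = 0 ∧
      b * chi n p.2 = 1),
    sgn (fA n m1 a p.1)

theorem pow_two_pow_add {F : Type*} [Field F] [CharP F 2] (k : ℕ) (x y : F) :
    (x + y) ^ 2 ^ k = x ^ 2 ^ k + y ^ 2 ^ k := by
  have : Fact (Nat.Prime 2) := ⟨Nat.prime_two⟩
  exact add_pow_char_pow ..

theorem absTr_sq_add_self {F : Type*} [Field F] [CharP F 2] (k : ℕ) (x : F) :
    absTr k (x ^ 2 + x) = x ^ 2 ^ k + x := by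
  induction k with
  | zero => simp [absTr, CharTwo.add_self_eq_zero]
  | succ k ih =>
    have h : absTr (k + 1) (x ^ 2 + x) = absTr k (x ^ 2 + x) + (x ^ 2 + x) ^ 2 ^ k := by
      simp [absTr, Finset.sum_range_succ]
    rw [h, ih, pow_two_pow_add, ← pow_mul, ← pow_succ']
    linear_combination CharTwo.add_self_eq_zero (x ^ 2 ^ k)

theorem absTr_two_mul {F : Type*} [Field F] [CharP F 2] (k : ℕ) (x : F) :
    absTr (2 * k) x = absTr k (x + x ^ 2 ^ k) := by
  rw [absTr_add, two_mul]
  simp only [absTr, Finset.sum_range_add, ← pow_mul, ← pow_add]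

theorem mem_range_algebraMap_of_pow_card_eq {F K : Type*} [Field F] [Fintype F] [Field K]
    [Algebra F K] {x : K} (hx : x ^ Fintype.card F = x) : x ∈ (algebraMap F K).range := by
  have h : (Polynomial.X ^ Fintype.card F - Polynomial.X : Polynomial F).Splits := by
    rw [Polynomial.splits_iff_card_roots, FiniteField.roots_X_pow_card_sub_X,
      FiniteField.X_pow_card_sub_X_natDegree_eq F Fintype.one_lt_card]
    rfl
  refine h.mem_range_of_isRoot
    (FiniteField.X_pow_card_sub_X_ne_zero F Fintype.one_lt_card) ?_
  simp [hx]

theorem exists_sq_add_self_eq {F : Type*} [Field F] [Fintype F] [CharP F 2] {k : ℕ}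
    (hF : Fintype.card F = 2 ^ (2 * k)) {c : F} (hc : absTr k c = 1) :
    ∃ x : F, x ^ 2 + x = c ∧ x ^ 2 ^ k = x + 1 := by
  let K := AlgebraicClosure F
  have : CharP K 2 := charP_of_injective_algebraMap (algebraMap F K).injective 2
  obtain ⟨x, hx⟩ : ∃ x : K, x ^ 2 + x = algebraMap F K c := by
    obtain ⟨x, hx⟩ := IsAlgClosed.exists_root
      (Polynomial.X ^ 2 + Polynomial.X - Polynomial.C (algebraMap F K c)) (by
        have : (Polynomial.X ^ 2 + Polynomial.X -
          Polynomial.C (algebraMap F K c)).degree = 2 := by compute_degree!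
        rw [this]; decide)
    exact ⟨x, by simpa [sub_eq_zero] using hx⟩
  have hxk : x ^ 2 ^ k = x + 1 := by
    have h1 : absTr k (algebraMap F K c) = 1 := by
      rw [← map_one (algebraMap F K), ← hc]
      simp [absTr]
    have h2 := absTr_sq_add_self k x
    rw [hx, h1] at h2
    linear_combination -h2 - CharTwo.add_self_eq_zero x
  have hxF : x ^ Fintype.card F = x := by
    rw [hF, two_mul, pow_add, pow_mul, hxk, pow_two_pow_add, hxk, one_pow]
    linear_combination CharTwo.add_self_eq_zero (1 : K)
  obtain ⟨z, rfl⟩ := mem_range_algebraMap_of_pow_card_eq hxF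
  refine ⟨z, ?_, ?_⟩ <;> apply (algebraMap F K).injective <;> simpa

theorem three_dvd_two_pow_sub_one (m : ℕ) : 3 ∣ 2 ^ (2 * m) - 1 := by
  simpa [pow_mul] using Nat.sub_dvd_pow_sub_pow 4 1 m

theorem pow_sub_one_eq_one {F : Type*} [Field F] {k : ℕ} {z : F} (hz : z ^ 2 ^ k = z)
    (hz0 : z ≠ 0) : z ^ (2 ^ k - 1) = 1 := by
  apply mul_right_cancel₀ hz0
  rw [← pow_succ, Nat.sub_add_cancel Nat.one_le_two_pow, hz, one_mul]

theorem two_pow_two_mul_sub_one (m : ℕ) : 2 ^ (2 * m) - 1 = (2 ^ m - 1) * (2 ^ m + 1) := by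
  rw [mul_comm 2 m, pow_mul, mul_comm, ← Nat.sq_sub_sq, one_pow]

theorem chi_mul {F : Type*} [Field F] (k : ℕ) (x y : F) : chi k (x * y) = chi k x * chi k y :=
  mul_pow ..

theorem chi_eq_one_of_mem_half {F : Type*} [Field F] {m : ℕ} (hm : Odd m) {z : F}
    (hz : z ^ 2 ^ m = z) (hz0 : z ≠ 0) : chi (2 * m) z = 1 := by
  rw [chi, two_pow_two_mul_sub_one, Nat.mul_div_assoc _ (three_dvd_two_pow_add_one hm), pow_mul,
    pow_sub_one_eq_one hz hz0, one_pow]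

theorem chi_pow_three_s14 {F : Type*} [Field F] {m : ℕ} {z : F}
    (hz : z ^ 2 ^ (2 * m) = z) (hz0 : z ≠ 0) : chi (2 * m) z ^ 3 = 1 := by
  rw [chi, ← pow_mul, Nat.div_mul_cancel (three_dvd_two_pow_sub_one m), pow_sub_one_eq_one hz hz0]

theorem chi_two_mul {F : Type*} [Field F] {m : ℕ} {z : F}
    (hz : z ^ 2 ^ (2 * m) = z) (hz0 : z ≠ 0) :
    chi (2 * (2 * m)) z = chi (2 * m) z ^ 2 := by
  obtain ⟨k, hk⟩ := three_dvd_two_pow_sub_one m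
  have hk' : 2 ^ (2 * m) + 1 = 3 * k + 2 := by
    have : 1 ≤ 2 ^ (2 * m) := Nat.one_le_two_pow
    omega
  have h : chi (2 * (2 * m)) z = chi (2 * m) z ^ (2 ^ (2 * m) + 1) := by
    rw [chi, two_pow_two_mul_sub_one, Nat.mul_comm,
      Nat.mul_div_assoc _ (three_dvd_two_pow_sub_one m), mul_comm, pow_mul, chi]
  rw [h, hk', pow_add, pow_mul, chi_pow_three_s14 hz hz0, one_pow, one_mul]

theorem pow_card_half_of_unit {F : Type*} [Field F] {m : ℕ} {u : F}
    (hu : u ^ (2 ^ m + 1) = 1) : u ^ 2 ^ m = u⁻¹ :=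
  eq_inv_of_mul_eq_one_left (by rwa [← pow_succ])

theorem pow_two_pow_of_unit {F : Type*} [Field F] {m : ℕ} {u : F}
    (hu : u ^ (2 ^ m + 1) = 1) : u ^ 2 ^ (2 * m) = u := by
  rw [two_mul, pow_add, pow_mul, pow_card_half_of_unit hu, inv_pow, pow_card_half_of_unit hu,
    inv_inv]

theorem ne_zero_of_unit {F : Type*} [Field F] {m : ℕ} {u : F}
    (hu : u ^ (2 ^ m + 1) = 1) : u ≠ 0 := by
  rintro rfl
  simp at hu

/-- The cubic condition on the `U_2`-component of `u₁ u₂`, rewritten as a condition on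
`t = (u₁ + u₁⁻¹)²`. -/
theorem mul_chi_eq_one_iff {F : Type*} [Field F] {m : ℕ} (hm : Odd m) {b w y u s : F}
    (hw : w ^ (2 ^ m + 1) = 1) (hy : y ^ 2 ^ m = y) (hy0 : y ≠ 0)
    (hu : u ^ (2 ^ m + 1) = 1) (hs : s ^ 2 ^ (2 * m) = s) (hs0 : s ≠ 0)
    (hz : (u * (w * y) * s) ^ 2 ^ m = u * (w * y) * s) :
    b * chi (2 * (2 * m)) u = 1 ↔ chi (2 * m) (s ^ 2) = b * chi (2 * m) w := by
  have hu0 := ne_zero_of_unit hu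
  have hw0 := ne_zero_of_unit hw
  have h1 := chi_eq_one_of_mem_half hm hz (by positivity)
  have hu3 := chi_pow_three_s14 (pow_two_pow_of_unit hu) hu0
  have hw3 := chi_pow_three_s14 (pow_two_pow_of_unit hw) hw0
  have hs3 := chi_pow_three_s14 hs hs0
  rw [chi_mul, chi_mul, chi_mul, chi_eq_one_of_mem_half hm hy hy0, mul_one] at h1
  rw [chi_two_mul (pow_two_pow_of_unit hu) hu0, pow_two s, chi_mul]
  generalize chi (2 * m) u = A at *
  generalize chi (2 * m) w = W at *
  generalize chi (2 * m) s = S at *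
  have hAW : S * S = A * W := by linear_combination (- S * S) * h1 + A * W * hs3
  rw [hAW]
  have hA0 : A ≠ 0 := by rintro rfl; simp at hu3
  have hW0 : W ≠ 0 := by rintro rfl; simp at hw3
  constructor
  · intro h
    linear_combination (-A * W) * h + b * W * hu3
  · intro h
    have : A = b := mul_right_cancel₀ hW0 h
    rw [← this]
    linear_combination hu3

theorem exists_unit_mul_mem_half {F : Type*} [Field F] {m : ℕ} (hm : m ≠ 0) {g : F}
    (hg : g ^ 2 ^ (2 * m) = g) (hg0 : g ≠ 0) :
    ∃ u : F, u ^ (2 ^ m + 1) = 1 ∧ (u * g) ^ 2 ^ m = u * g := by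
  obtain ⟨k, rfl⟩ := Nat.exists_eq_succ_of_ne_zero hm
  have h1 := pow_sub_one_eq_one hg hg0
  rw [two_pow_two_mul_sub_one] at h1
  obtain ⟨r, hr⟩ : ∃ r, 2 ^ k = r + 1 :=
    Nat.exists_eq_succ_of_ne_zero (pow_ne_zero k two_ne_zero)
  have hq : 2 ^ (k + 1) = 2 * r + 2 := by rw [pow_succ, hr]; ring
  have hq1 : 2 * r + 2 - 1 = 2 * r + 1 := by omega
  rw [Nat.succ_eq_add_one, hq]
  rw [Nat.succ_eq_add_one, hq, hq1] at h1
  refine ⟨g ^ ((2 * r + 1) * (r + 2)), ?_, ?_⟩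
  · rw [← pow_mul, show (2 * r + 1) * (r + 2) * (2 * r + 2 + 1)
      = (2 * r + 1) * (2 * r + 2 + 1) * (r + 2) by ring, pow_mul, h1, one_pow]
  · rw [← pow_succ, ← pow_mul, show ((2 * r + 1) * (r + 2) + 1) * (2 * r + 2)
      = (2 * r + 1) * (2 * r + 2 + 1) * (r + 1) + ((2 * r + 1) * (r + 2) + 1) by ring, pow_add,
      pow_mul, h1, one_pow, one_mul]

theorem unit_eq_of_mul_mem_half {F : Type*} [Field F] [CharP F 2] {m : ℕ} {g u v : F}
    (hg0 : g ≠ 0) (hu : u ^ (2 ^ m + 1) = 1) (hv : v ^ (2 ^ m + 1) = 1)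
    (hug : (u * g) ^ 2 ^ m = u * g) (hvg : (v * g) ^ 2 ^ m = v * g) : u = v := by
  have hu0 := ne_zero_of_unit hu
  have hv0 := ne_zero_of_unit hv
  rw [mul_pow, pow_card_half_of_unit hu] at hug
  rw [mul_pow, pow_card_half_of_unit hv] at hvg
  have h1 : g ^ 2 ^ m = u ^ 2 * g := by field_simp at hug; linear_combination hug
  have h2 : g ^ 2 ^ m = v ^ 2 * g := by field_simp at hvg; linear_combination hvg
  exact CharTwo.sq_injective (mul_right_cancel₀ hg0 (h1.symm.trans h2))

theorem add_inv_pow_two_pow {F : Type*} [Field F] [CharP F 2] {k : ℕ} {u : F}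
    (hu : u ^ (2 ^ k + 1) = 1) : (u + u⁻¹) ^ 2 ^ k = u + u⁻¹ := by
  rw [pow_two_pow_add, inv_pow, pow_card_half_of_unit hu, inv_inv, add_comm]

/-- Membership in the index set of `S2`, for `ω` in the subfield `GF(2^{2m})`. -/
theorem relTr_conditions_iff {F : Type*} [Field F] [CharP F 2] {m : ℕ} (hm : m ≠ 0)
    {ω u v : F} (hω : ω ^ 2 ^ (2 * m) = ω) (hω0 : ω ≠ 0)
    (hu : u ^ (2 ^ (2 * m) + 1) = 1) (hv : v ^ (2 ^ m + 1) = 1) :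
    (relTr (4 * m) (2 * m) (u * v * ω) ≠ 0 ↔ u + u⁻¹ ≠ 0) ∧
    (relTr (4 * m) m (u * v * ω) = 0 ↔
      (v * ω * (u + u⁻¹)) ^ 2 ^ m = v * ω * (u + u⁻¹)) := by
  have hv0 := ne_zero_of_unit hv
  have e1 : 4 * m / (2 * m) = 2 := by
    rw [show 4 * m = 2 * (2 * m) by ring]; exact Nat.mul_div_cancel _ (by omega)
  have e2 : 4 * m / m = 4 := Nat.mul_div_cancel _ (by omega)
  have hc : (u * v * ω) ^ 2 ^ (2 * m) = u⁻¹ * v * ω := by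
    rw [mul_pow, mul_pow, hω, pow_two_pow_of_unit hv, pow_card_half_of_unit hu]
  have h1 : relTr (4 * m) (2 * m) (u * v * ω) = v * ω * (u + u⁻¹) := by
    simp only [relTr, e1, Finset.sum_range_succ, Finset.sum_range_zero, mul_zero, mul_one, pow_zero,
      pow_one, zero_add, hc]
    ring
  have h2 : relTr (4 * m) m (u * v * ω) =
      v * ω * (u + u⁻¹) + (v * ω * (u + u⁻¹)) ^ 2 ^ m := by
    have hc3 : (u * v * ω) ^ 2 ^ (m * 3) = (u⁻¹ * v * ω) ^ 2 ^ m := by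
      rw [show m * 3 = 2 * m + m by ring, pow_add, pow_mul, hc]
    have hs : v * ω * (u + u⁻¹) = u * v * ω + u⁻¹ * v * ω := by ring
    simp only [relTr, e2, Finset.sum_range_succ, Finset.sum_range_zero, mul_zero, mul_one, pow_zero,
      pow_one, zero_add, hc3]
    rw [mul_comm m 2, hc, hs, pow_two_pow_add]
    ring
  refine ⟨by rw [h1]; simp [hv0, hω0], ?_⟩
  rw [h2, CharTwo.add_eq_zero, eq_comm]

theorem absTr_inv_add_inv_sq {F : Type*} [Field F] [CharP F 2] {k : ℕ} {u : F}
    (hu : u ^ (2 ^ k + 1) = 1) (hs : u + u⁻¹ ≠ 0) : absTr k ((u + u⁻¹) ^ 2)⁻¹ = 1 := by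
  have hu0 := ne_zero_of_unit hu
  have h2 : (2 : F) = 0 := CharTwo.two_eq_zero
  have hx : (u / (u + u⁻¹)) ^ 2 + u / (u + u⁻¹) = ((u + u⁻¹) ^ 2)⁻¹ := by
    have h1 : u * u + u * (u + u⁻¹) = 1 := by
      linear_combination u * u * h2 + mul_inv_cancel₀ hu0
    generalize u + u⁻¹ = s at hs h1
    field_simp
    linear_combination h1
  rw [← hx, absTr_sq_add_self, div_pow, add_inv_pow_two_pow hu, pow_card_half_of_unit hu,
    ← add_div, add_comm, div_self hs]

theorem fA_of_unit {F : Type*} [Field F] [CharP F 2] {k : ℕ} {a u : F} (ha : a ^ 2 ^ k = a)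
    (hu : u ^ (2 ^ k + 1) = 1) : fA (2 * k) k a u = absTr k (a * (u + u⁻¹) ^ 2) := by
  have hu0 := ne_zero_of_unit hu
  have h : u ^ (2 ^ k - 1) = (u⁻¹) ^ 2 := by
    apply mul_right_cancel₀ hu0
    rw [← pow_succ, Nat.sub_add_cancel Nat.one_le_two_pow, pow_card_half_of_unit hu]
    field_simp
  rw [fA, absTr_two_mul, h, mul_pow, ha, ← pow_mul, mul_comm 2, pow_mul u⁻¹, inv_pow u (2 ^ k),
    pow_card_half_of_unit hu, inv_inv, CharTwo.add_sq]
  congr 1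
  ring

theorem exists_unit_add_inv_sq_eq {F : Type*} [Field F] [Fintype F] [CharP F 2] {k : ℕ}
    (hF : Fintype.card F = 2 ^ (2 * k)) {t : F} (ht : t ^ 2 ^ k = t) (htr : absTr k t⁻¹ = 1) :
    ∃ u : F, u ^ (2 ^ k + 1) = 1 ∧ (u + u⁻¹) ^ 2 = t := by
  have h2 : (2 : F) = 0 := CharTwo.two_eq_zero
  have ht0 : t ≠ 0 := by
    rintro rfl
    simp [absTr] at htr
  obtain ⟨x, hx, hxk⟩ := exists_sq_add_self_eq hF htr
  obtain ⟨s, rfl⟩ : ∃ s, s ^ 2 = t := by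
    obtain ⟨s, hs⟩ := FiniteField.isSquare_of_char_two (CharP.ringChar_of_prime_eq_zero
      Nat.prime_two (by exact_mod_cast h2)) t
    exact ⟨s, by rw [hs, pow_two]⟩
  have hs0 : s ≠ 0 := by rintro rfl; simp at ht0
  have hs : s ^ 2 ^ k = s := CharTwo.sq_injective (by
    simpa only [← pow_mul, mul_comm] using ht)
  have hu : (s * x) * (s * (x + 1)) = 1 := by
    calc _ = s ^ 2 * (x ^ 2 + x) := by ring
      _ = 1 := by rw [hx, mul_inv_cancel₀ ht0]
  refine ⟨s * x, ?_, ?_⟩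
  · rw [pow_succ, mul_pow, hs, hxk, mul_comm, hu]
  · rw [inv_eq_of_mul_eq_one_right hu]
    congr 1
    linear_combination s * x * h2

theorem eq_or_eq_inv_of_add_inv_eq {F : Type*} [Field F] {u v : F} (hu : u ≠ 0) (hv : v ≠ 0)
    (h : v + v⁻¹ = u + u⁻¹) : v = u ∨ v = u⁻¹ := by
  have h' : (v - u) * (v - u⁻¹) = 0 := by
    linear_combination v * h - mul_inv_cancel₀ hv + mul_inv_cancel₀ hu
  rcases mul_eq_zero.1 h' with h | h
  · exact .inl (sub_eq_zero.1 h)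
  · exact .inr (sub_eq_zero.1 h)

/-- For `ν = 2` (so `n = 4·m₂` with `m₂` odd, `m₁ = 2·m₂`), `a ∈ F_{2^{m₁}}^*`,
`b ∈ F_4^*` and `ω ∈ F_{2^{m₁}}^*` with polar decomposition `ω = w₂·y` in `F_{2^{m₁}}^*`
(`w₂ ∈ U_2`, `y ∈ F_{2^{m₂}}^*`), setting `γ = b·χ_{m₁}(w₂)`:
`S_2(a, b, ω) = 2 · ∑_{t ∈ T¹_{m₁}, χ_{m₁}(t) = γ} (−1)^{Tr^{m₁}(a·t)}`. -/
theorem S2_subfield_case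
    {F : Type*} [Field F] [Fintype F]
    (n m1 m2 : ℕ) (hm2 : Odd m2) (hm1 : m1 = 2 * m2) (hn : n = 4 * m2)
    (hF : Fintype.card F = 2 ^ n)
    (a b : F) (ha : a ^ 2 ^ m1 = a) (ha0 : a ≠ 0) (hb : b ^ 3 = 1) (hb0 : b ≠ 0)
    (ω w2 y : F) (hω : ω ^ 2 ^ m1 = ω) (hω0 : ω ≠ 0)
    (hw2 : w2 ^ (2 ^ m2 + 1) = 1) (hy : y ^ 2 ^ m2 = y) (hy0 : y ≠ 0)
    (hdec : ω = w2 * y)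
    (γ : F) (hγ : γ = b * chi m1 w2) :
    S2 n m1 m2 a b ω
      = 2 * ∑ t ∈ (gf F m1).filter (fun t => absTr m1 t⁻¹ = 1 ∧ chi m1 t = γ),
          sgn (absTr m1 (a * t)) := by
  subst hm1 hγ hdec
  obtain rfl : n = 2 * (2 * m2) := by rw [hn]; ring
  have : Fact (Nat.Prime 2) := ⟨Nat.prime_two⟩
  have : CharP F 2 := charP_of_card_eq_prime_pow hF
  have hm0 : m2 ≠ 0 := by rintro rfl; simp at hm2
  have h4 : 2 * (2 * m2) = 4 * m2 := by ring
  have hmem (u v : F) (hu : u ^ (2 ^ (2 * m2) + 1) = 1) (hv : v ^ (2 ^ m2 + 1) = 1) :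
      (relTr (2 * (2 * m2)) (2 * m2) (u * v * (w2 * y)) ≠ 0 ∧
        relTr (2 * (2 * m2)) m2 (u * v * (w2 * y)) = 0 ∧ b * chi (2 * (2 * m2)) v = 1) ↔
      u + u⁻¹ ≠ 0 ∧
        (v * (w2 * y) * (u + u⁻¹)) ^ 2 ^ m2 = v * (w2 * y) * (u + u⁻¹) ∧
        chi (2 * m2) ((u + u⁻¹) ^ 2) = b * chi (2 * m2) w2 := by
    obtain ⟨h1, h2⟩ := relTr_conditions_iff hm0 hω hω0 hu hv
    rw [← h4] at h1 h2
    rw [h1, h2]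
    refine and_congr_right fun hs => and_congr_right fun hz => ?_
    exact mul_chi_eq_one_iff hm2 hw2 hy hy0 hv (add_inv_pow_two_pow hu) hs hz
  rw [S2, Finset.mul_sum]
  rw [← Finset.sum_fiberwise_of_maps_to (g := fun p : F × F => (p.1 + p.1⁻¹) ^ 2)
    (t := (gf F (2 * m2)).filter
      (fun t => absTr (2 * m2) t⁻¹ = 1 ∧ chi (2 * m2) t = b * chi (2 * m2) w2))]
  · refine Finset.sum_congr rfl fun t ht => ?_
    simp only [gf, Finset.mem_filter, Finset.mem_univ, true_and] at ht
    obtain ⟨htk, htr, hchi⟩ := ht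
    obtain ⟨u, hu, rfl⟩ := exists_unit_add_inv_sq_eq hF htk htr
    have hs : u + u⁻¹ ≠ 0 := by
      intro h
      simp [h, absTr] at htr
    have hu0 := ne_zero_of_unit hu
    have hne : u ≠ u⁻¹ := fun h => hs (CharTwo.add_eq_zero.2 h)
    have hg0 : w2 * y * (u + u⁻¹) ≠ 0 := mul_ne_zero hω0 hs
    obtain ⟨v, hv, hvz⟩ := exists_unit_mul_mem_half hm0 (g := w2 * y * (u + u⁻¹))
      (by rw [mul_pow, hω, add_inv_pow_two_pow hu]) hg0
    have huinv : u⁻¹ ^ (2 ^ (2 * m2) + 1) = 1 := by rw [inv_pow, hu, inv_one]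
    have hfib : (({p : F × F | p.1 ^ (2 ^ (2 * m2) + 1) = 1 ∧ p.2 ^ (2 ^ m2 + 1) = 1 ∧
        relTr (2 * (2 * m2)) (2 * m2) (p.1 * p.2 * (w2 * y)) ≠ 0 ∧
        relTr (2 * (2 * m2)) m2 (p.1 * p.2 * (w2 * y)) = 0 ∧
        b * chi (2 * (2 * m2)) p.2 = 1} : Finset (F × F)).filter
          fun p => (p.1 + p.1⁻¹) ^ 2 = (u + u⁻¹) ^ 2) = {(u, v), (u⁻¹, v)} := by
      ext ⟨u', v'⟩
      simp only [Finset.mem_filter, Finset.mem_univ, true_and, Finset.mem_insert,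
        Finset.mem_singleton, Prod.mk.injEq, CharTwo.sq_inj]
      constructor
      · rintro ⟨⟨hu', hv', h⟩, hss⟩
        obtain ⟨-, hz, -⟩ := (hmem u' v' hu' hv').1 h
        have hvv : v' = v := unit_eq_of_mul_mem_half hg0 hv' hv
          (by rw [← hss, ← mul_assoc]; exact hz) hvz
        rcases eq_or_eq_inv_of_add_inv_eq hu0 (ne_zero_of_unit hu') hss with h | h
        · exact .inl ⟨h, hvv⟩
        · exact .inr ⟨h, hvv⟩
      · rintro (⟨rfl, rfl⟩ | ⟨rfl, rfl⟩)
        · exact ⟨⟨hu, hv, (hmem _ _ hu hv).2 ⟨hs, by rwa [mul_assoc], hchi⟩⟩, rfl⟩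
        · have hcomm : u⁻¹ + u⁻¹⁻¹ = u + u⁻¹ := by rw [inv_inv, add_comm]
          refine ⟨⟨huinv, hv, (hmem _ _ huinv hv).2 ?_⟩, hcomm⟩
          rw [hcomm]
          exact ⟨hs, by rwa [mul_assoc], hchi⟩
    rw [hfib, Finset.sum_pair (by simp [hne]), fA_of_unit ha hu, fA_of_unit ha huinv, inv_inv,
      add_comm u⁻¹ u, ← two_mul]
  · rintro ⟨u, v⟩ h
    simp only [gf, Finset.mem_filter, Finset.mem_univ, true_and] at h ⊢
    obtain ⟨hu, hv, h⟩ := h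
    obtain ⟨hs, -, hchi⟩ := (hmem u v hu hv).1 h
    exact ⟨by rw [← pow_mul, mul_comm, pow_mul, add_inv_pow_two_pow hu],
      absTr_inv_add_inv_sq hu hs, hchi⟩
end
end
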